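/- Let x : [0, v_max] → [0, 1] be a monotonically non-decreasing allocation rule with x(0) = 0 that is right-differentiable with finitely many non-differentiable points. If p and q are two payment rules with p(0) = q(0) = 0 such that both mechanisms (x, p) and (x, q) are DSIC and IR, then p(v) = q(v) for all v ∈ [0, v_max]. -/

import Mathlib

open Set MeasureTheory

/-- Myerson payment of an allocation rule `x`: `p̃(v) = v·x(v) − ∫₀^v x(z) dz`. -/
noncomputable def myersonPayment (x : ℝ → ℝ) (v : ℝ) : ℝ :=
  v * x v - ∫ z in (0:ℝ)..v, x z

/-- ROI payment rule associated with allocation `x` and ROI parameter `M`: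
`p(v) = M·p̃(v) − max_{0 ≤ z ≤ v} (M·p̃(z) − z·x(z))`. -/
noncomputable def roiPayment (M : ℝ) (x : ℝ → ℝ) (v : ℝ) : ℝ :=
  M * myersonPayment x v -
    sSup ((fun z => M * myersonPayment x z - z * x z) '' Set.Icc 0 v)

/-- Utility of a bidder with value `v` who bids `b`: `M·v·x(b) − p(b)` if the
ex post ROI (IR) condition `p(b) ≤ v·x(b)` holds, and `−∞` otherwise. -/
noncomputable def utility (M : ℝ) (x p : ℝ → ℝ) (b v : ℝ) : EReal :=
  if p b ≤ v * x b then ((M * v * x b - p b : ℝ) : EReal) else ⊥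

/-- Dominant-strategy incentive compatibility. -/
def DSIC (M vmax : ℝ) (x p : ℝ → ℝ) : Prop :=
  ∀ v ∈ Set.Icc (0:ℝ) vmax, ∀ b ∈ Set.Icc (0:ℝ) vmax,
    utility M x p b v ≤ utility M x p v v

/-- Individual rationality. -/
def IR (M vmax : ℝ) (x p : ℝ → ℝ) : Prop :=
  ∀ v ∈ Set.Icc (0:ℝ) vmax, (0 : EReal) ≤ utility M x p v v

/-- The allocation rule is right-differentiable on `[0, vmax]` with finitely many
non-differentiable points. -/
def RightDiffFin (vmax : ℝ) (x : ℝ → ℝ) : Prop :=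
  ∃ s : Finset ℝ, ∀ v ∈ Set.Icc (0:ℝ) vmax, v ∉ s →
    DifferentiableWithinAt ℝ x (Set.Ici v) v

/-- Individual rationality forces truthful bids to satisfy the ROI constraint. -/
lemma IR.payment_le {M vmax : ℝ} {x p : ℝ → ℝ} (h : IR M vmax x p) {v : ℝ}
    (hv : v ∈ Set.Icc (0:ℝ) vmax) : p v ≤ v * x v := by
  by_contra hc
  have := h v hv
  simp [utility, hc] at this

/-- A deviation satisfying the ROI constraint is not profitable. -/
lemma DSIC.utility_le {M vmax : ℝ} {x p : ℝ → ℝ} (h : DSIC M vmax x p) (hir : IR M vmax x p)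
    {v b : ℝ} (hv : v ∈ Set.Icc (0:ℝ) vmax) (hb : b ∈ Set.Icc (0:ℝ) vmax)
    (hpb : p b ≤ v * x b) : M * v * x b - p b ≤ M * v * x v - p v := by
  have := h v hv b hb
  rwa [utility, utility, if_pos hpb, if_pos (hir.payment_le hv), EReal.coe_le_coe_iff] at this

/-- Where `p` exceeds `q` by at least the step `v - w`, the difference `p - q` cannot drop by much
when moving from `v` down to `w`. -/
lemma payment_sub_step {M vmax : ℝ} {x p q : ℝ → ℝ}
    (hxrange : ∀ v ∈ Set.Icc (0:ℝ) vmax, x v ∈ Set.Icc (0:ℝ) 1)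
    (hdsicp : DSIC M vmax x p) (hirp : IR M vmax x p)
    (hdsicq : DSIC M vmax x q) (hirq : IR M vmax x q) {v w : ℝ}
    (hv : v ∈ Set.Icc (0:ℝ) vmax) (hw : w ∈ Set.Icc (0:ℝ) vmax) (hwv : w ≤ v)
    (hgap : v - w ≤ p v - q v) :
    p v - q v - M * (v - w) * (x v - x w) ≤ p w - q w := by
  obtain ⟨hxv0, hxv1⟩ := hxrange v hv
  obtain ⟨hxw0, -⟩ := hxrange w hw
  have hpv := hirp.payment_le hv
  have hpw := hirp.payment_le hw
  have hup := hdsicq.utility_le hirq hw hv (by nlinarith)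
  have hdown := hdsicp.utility_le hirp hv hw (by nlinarith)
  nlinarith

lemma payment_le_of_dsic {M vmax : ℝ} (hM : 0 < M) {x p q : ℝ → ℝ}
    (hxrange : ∀ v ∈ Set.Icc (0:ℝ) vmax, x v ∈ Set.Icc (0:ℝ) 1)
    (hpq0 : p 0 = q 0)
    (hdsicp : DSIC M vmax x p) (hirp : IR M vmax x p)
    (hdsicq : DSIC M vmax x q) (hirq : IR M vmax x q) {v : ℝ}
    (hv : v ∈ Set.Icc (0:ℝ) vmax) : p v ≤ q v := by
  by_contra! hlt
  set c := p v - q v with hc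
  have hcpos : 0 < c := sub_pos.2 hlt
  obtain ⟨n, hn⟩ := exists_nat_gt (2 * (M + 1) * v / c)
  have hn0 : (0:ℝ) < n := lt_of_le_of_lt (by have := hv.1; positivity) hn
  set δ := v / n with hδ
  have hδ0 : 0 ≤ δ := div_nonneg hv.1 hn0.le
  have hnδ : n * δ = v := mul_div_cancel₀ v hn0.ne'
  have hδc : 2 * (M + 1) * δ ≤ c := by
    rw [div_lt_iff₀ hcpos] at hn
    rw [hδ, ← mul_div_assoc, div_le_iff₀ hn0]
    linarith
  have hmem : ∀ k : ℕ, k ≤ n → v - k * δ ∈ Set.Icc (0:ℝ) vmax := fun k hk => by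
    have hk' : (k:ℝ) * δ ≤ n * δ := by gcongr
    have : 0 ≤ (k:ℝ) * δ := by positivity
    exact ⟨by linarith, by linarith [hv.2]⟩
  have hdiff : ∀ w ∈ Set.Icc (0:ℝ) vmax, M * δ * (x v - x w) ≤ M * δ := fun w hw =>
    mul_le_of_le_one_right (by positivity) (by linarith [(hxrange v hv).2, (hxrange w hw).1])
  have key : ∀ k : ℕ, k ≤ n →
      c - M * δ * (x v - x (v - k * δ)) ≤ p (v - k * δ) - q (v - k * δ) := by
    intro k
    induction k with
    | zero => intro _; simp [hc]
    | succ k ih =>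
      intro hk
      have ih := ih (by omega)
      have hm := hmem k (by omega)
      have hstep : v - k * δ - (v - (k + 1 : ℕ) * δ) = δ := by push_cast; ring
      have := payment_sub_step hxrange hdsicp hirp hdsicq hirq hm (hmem (k + 1) hk)
        (by linarith) (by rw [hstep]; nlinarith [hdiff _ hm])
      rw [hstep] at this
      linarith
  have hlast := key n le_rfl
  have hd := hdiff _ (hmem n le_rfl)
  rw [hnδ, sub_self] at hlast hd
  nlinarith

/-- uniqueness of the payment rule: given a monotone,
right-differentiable allocation rule, any two payment rules that make the
mechanism DSIC and IR agree on `[0, v_max]`. -/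
theorem payment_unique (vmax M : ℝ) (hvmax : 0 < vmax) (hM : 1 < M)
    (x p q : ℝ → ℝ)
    (hx0 : x 0 = 0) (hxrange : ∀ v ∈ Set.Icc (0:ℝ) vmax, x v ∈ Set.Icc (0:ℝ) 1)
    (hmono : MonotoneOn x (Set.Icc 0 vmax))
    (hxdiff : RightDiffFin vmax x)
    (hp0 : p 0 = 0) (hq0 : q 0 = 0)
    (hdsicp : DSIC M vmax x p) (hirp : IR M vmax x p)
    (hdsicq : DSIC M vmax x q) (hirq : IR M vmax x q) :
    ∀ v ∈ Set.Icc (0:ℝ) vmax, p v = q v := by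
  intro v hv
  have hM0 : 0 < M := by linarith
  have hpq0 : p 0 = q 0 := hp0.trans hq0.symm
  exact le_antisymm
    (payment_le_of_dsic hM0 hxrange hpq0 hdsicp hirp hdsicq hirq hv)
    (payment_le_of_dsic hM0 hxrange hpq0.symm hdsicq hirq hdsicp hirp hv)
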